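/- For real numbers k > l ≥ exp^n(2) (with n ∈ ℕ), one has k (log k)(log^2 k)⋯(log^n k) · log(log^n k / log^n l) ≥ (log 2)^{n+1} (k − l). -/

import Mathlib

theorem Real.sub_le_mul_log_div {x y : ℝ} (hx : 0 < x) (hy : 0 < y) :
    x - y ≤ x * Real.log (x / y) := by
  have h := Real.one_sub_inv_le_log_of_pos (div_pos hx hy)
  calc x - y = x * (1 - (x / y)⁻¹) := by field_simp
    _ ≤ x * Real.log (x / y) := by gcongr

/-- For `k > l ≥ exp^n(2)`, one has `k (log k)⋯(log^n k) · log(log^n k / log^n l) ≥ k − l`. -/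
theorem Real.sub_le_prod_iterate_log_mul_log_div (n : ℕ) (k l : ℝ) (hl : Real.exp^[n] 2 ≤ l)
    (hkl : l < k) :
    k - l ≤ (∏ i ∈ Finset.range (n + 1), Real.log^[i] k) *
      Real.log (Real.log^[n] k / Real.log^[n] l) := by
  induction n generalizing k l with
  | zero =>
    have hl0 : 0 < l := lt_of_lt_of_le two_pos hl
    simpa using Real.sub_le_mul_log_div (hl0.trans hkl) hl0
  | succ n ih =>
    rw [Function.iterate_succ_apply'] at hl
    have hl0 : 0 < l := (Real.exp_pos _).trans_le hl
    have hk0 : 0 < k := hl0.trans hkl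
    have h := ih (Real.log k) (Real.log l) ((Real.le_log_iff_exp_le hl0).2 hl)
      (Real.log_lt_log hl0 hkl)
    rw [Finset.prod_range_succ']
    simp only [Function.iterate_succ_apply, Function.iterate_zero, id]
    calc k - l ≤ k * Real.log (k / l) := Real.sub_le_mul_log_div hk0 hl0
      _ = k * (Real.log k - Real.log l) := by rw [Real.log_div hk0.ne' hl0.ne']
      _ ≤ _ := mul_le_mul_of_nonneg_left h hk0.le
      _ = _ := by ring

/-- For `k > l ≥ exp^n(2)`, one has
`k (log k)⋯(log^n k) · log(log^n k / log^n l) ≥ (log 2)^{n+1} (k − l)`. -/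
theorem stmt13 (n : ℕ) (k l : ℝ) (hl : Real.exp^[n] 2 ≤ l) (hkl : l < k) :
    (Real.log 2) ^ (n + 1) * (k - l) ≤
      k * (∏ i ∈ Finset.Icc 1 n, Real.log^[i] k) *
        Real.log (Real.log^[n] k / Real.log^[n] l) := by
  have hprod : k * (∏ i ∈ Finset.Icc 1 n, Real.log^[i] k) =
      ∏ i ∈ Finset.range (n + 1), Real.log^[i] k := by
    rw [Finset.range_eq_Ico, Finset.prod_eq_prod_Ico_succ_bot n.succ_pos]
    rfl
  have hlog : Real.log 2 ^ (n + 1) ≤ 1 :=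
    pow_le_one₀ (Real.log_nonneg one_le_two) (by linarith [Real.log_two_lt_d9])
  rw [hprod]
  exact (mul_le_of_le_one_left (sub_nonneg.2 hkl.le) hlog).trans
    (Real.sub_le_prod_iterate_log_mul_log_div n k l hl hkl)
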